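/- (Exact solver of the OE procedure.) For each cell I_j let {φ_j^{(i)}}_{i=0}^k be an L²(I_j)-orthogonal basis of ℙ^k(I_j) with deg φ_j^{(i)} = i and φ_j^{(0)} constant (e.g., the scaled Legendre polynomials), and write u|_{I_j} = Σ_{i=0}^k u_j^{(i)}(0) φ_j^{(i)}. Then the unique solution of the damping initial value problem with initial data u is given on I_j, for all t̂ ≥ 0, by u_σ(x, t̂) = u_j^{(0)}(0) φ_j^{(0)}(x) + Σ_{i=1}^k exp( −(β_j t̂ / h_j) Σ_{m=0}^i σ_j^m(u) ) u_j^{(i)}(0) φ_j^{(i)}(x). In particular F_τ u is obtained by multiplying the i-th modal coefficient of u on I_j by exp(−(β_j τ/h_j) Σ_{m=0}^i σ_j^m(u)) for i ≥ 1 and leaving the mean coefficient unchanged. -/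

import Mathlib

open Polynomial Finset MeasureTheory

namespace OEDG

variable {N : ℕ}

/-- `pt` lists the nodes `x_{1/2} < x_{3/2} < … < x_{N+1/2}` of a partition of `Ω = [0,1]`. -/
def IsMesh (pt : Fin (N+1) → ℝ) : Prop :=
  pt 0 = 0 ∧ pt (Fin.last N) = 1 ∧ StrictMono pt

/-- Left endpoint of cell `j`. -/
def ptL (pt : Fin (N+1) → ℝ) (j : Fin N) : ℝ := pt j.castSucc

/-- Right endpoint of cell `j`. -/
def ptR (pt : Fin (N+1) → ℝ) (j : Fin N) : ℝ := pt j.succ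

/-- Length `h_j` of cell `j`. -/
def cellh (pt : Fin (N+1) → ℝ) (j : Fin N) : ℝ := ptR pt j - ptL pt j

/-- Maximal mesh size `h`. -/
noncomputable def meshSize (pt : Fin (N+1) → ℝ) : ℝ := ⨆ j : Fin N, cellh pt j

/-- Quasi-uniformity of the partition: `h ≤ γ h_j` for all `j`. -/
def QuasiUniform (pt : Fin (N+1) → ℝ) (γ : ℝ) : Prop :=
  ∀ j : Fin N, meshSize pt ≤ γ * cellh pt j

/-- Membership in `V^k`: every cell polynomial has degree at most `k`. -/
def MemVk (k : ℕ) (u : Fin N → Polynomial ℝ) : Prop :=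
  ∀ j, (u j).natDegree ≤ k

/-- Cellwise `L²` inner product. -/
noncomputable def cip (pt : Fin (N+1) → ℝ) (j : Fin N) (p q : Polynomial ℝ) : ℝ :=
  ∫ x in (ptL pt j)..(ptR pt j), p.eval x * q.eval x

/-- Global `L²(Ω)` inner product of piecewise polynomials. -/
noncomputable def ip (pt : Fin (N+1) → ℝ) (u v : Fin N → Polynomial ℝ) : ℝ :=
  ∑ j : Fin N, cip pt j (u j) (v j)

/-- Cellwise `L²` norm. -/
noncomputable def cl2 (pt : Fin (N+1) → ℝ) (j : Fin N) (p : Polynomial ℝ) : ℝ :=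
  Real.sqrt (cip pt j p p)

/-- Global `L²(Ω)` norm of a piecewise polynomial. -/
noncomputable def l2 (pt : Fin (N+1) → ℝ) (u : Fin N → Polynomial ℝ) : ℝ :=
  Real.sqrt (ip pt u u)

/-- Average `avg(u) = (1/|Ω|) ∫_Ω u dx` (here `|Ω| = 1`). -/
noncomputable def avg (pt : Fin (N+1) → ℝ) (u : Fin N → Polynomial ℝ) : ℝ :=
  ∑ j : Fin N, ∫ x in (ptL pt j)..(ptR pt j), (u j).eval x

/-- `‖u - c‖_{L∞(Ω)}` for a piecewise polynomial `u` and a constant `c`. -/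
noncomputable def linfSub (pt : Fin (N+1) → ℝ) (u : Fin N → Polynomial ℝ) (c : ℝ) : ℝ :=
  ⨆ j : Fin N, sSup ((fun x => |(u j).eval x - c|) '' Set.Icc (ptL pt j) (ptR pt j))

/-- `m`-th derivative of a polynomial. -/
noncomputable def pderiv (m : ℕ) (p : Polynomial ℝ) : Polynomial ℝ :=
  (fun q : Polynomial ℝ => Polynomial.derivative q)^[m] p

/-- Jump `[∂_x^m u]_{j+1/2}` of the `m`-th derivative at the interface to the right of
cell `j`, with periodic identification of `x_{N+1/2}` with `x_{1/2}`. -/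
noncomputable def jumpD [NeZero N] (pt : Fin (N+1) → ℝ) (u : Fin N → Polynomial ℝ)
    (m : ℕ) (j : Fin N) : ℝ :=
  (pderiv m (u (j+1))).eval (pt (Fin.castSucc (j+1))) - (pderiv m (u j)).eval (pt j.succ)

/-- The scale-invariant damping coefficient `σ_j^m(u)` of the OEDG method. -/
noncomputable def sigma [NeZero N] (k : ℕ) (pt : Fin (N+1) → ℝ)
    (u : Fin N → Polynomial ℝ) (m : ℕ) (j : Fin N) : ℝ :=
  if ∀ i, u i = Polynomial.C (avg pt u) then 0
  else (2*(m:ℝ)+1) * (cellh pt j)^m / ((2*(k:ℝ)-1) * (Nat.factorial m)) *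
    ((|jumpD pt u m (j-1)| + |jumpD pt u m j|) / (2 * linfSub pt u (avg pt u)))

/-- Damping rate `δ_j^m = β_j σ_j^m(u) / h_j`. -/
noncomputable def dampRate [NeZero N] (k : ℕ) (pt : Fin (N+1) → ℝ) (β : Fin N → ℝ)
    (u : Fin N → Polynomial ℝ) (m : ℕ) (j : Fin N) : ℝ :=
  β j * sigma k pt u m j / cellh pt j

/-- `Pc j d` is the cellwise `L²(I_j)`-orthogonal projection onto `ℙ^d(I_j)`.
(The family `Pc` realizes the global projections `P^d` onto `V^d`.) -/
def IsCellProj (pt : Fin (N+1) → ℝ)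
    (Pc : Fin N → ℕ → Polynomial ℝ → Polynomial ℝ) : Prop :=
  ∀ (j : Fin N) (dd : ℕ) (p : Polynomial ℝ), (Pc j dd p).natDegree ≤ dd ∧
    ∀ q : Polynomial ℝ, q.natDegree ≤ dd → cip pt j (p - Pc j dd p) q = 0

/-- `w` solves the damping initial value problem with initial data `u`:
`d/dt̂ ∫_{I_j} u_σ v dx + ∑_{m=0}^k (β_j σ_j^m(u)/h_j) ∫_{I_j} (u_σ - P^{m-1} u_σ) v dx = 0`
for every `v ∈ ℙ^k(I_j)` and every `j`, with `u_σ(·,0) = u`.  (Note `m - 1` is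
truncated ℕ-subtraction, which realizes the convention `P^{-1} = P^0`.) -/
def IsDampingSol [NeZero N] (k : ℕ) (pt : Fin (N+1) → ℝ) (β : Fin N → ℝ)
    (Pc : Fin N → ℕ → Polynomial ℝ → Polynomial ℝ)
    (u : Fin N → Polynomial ℝ) (w : ℝ → Fin N → Polynomial ℝ) : Prop :=
  w 0 = u ∧ (∀ t j, (w t j).natDegree ≤ k) ∧
  ∀ (t : ℝ) (j : Fin N) (v : Polynomial ℝ), v.natDegree ≤ k →
    HasDerivAt (fun s => cip pt j (w s j) v)
      (-(∑ m ∈ Finset.range (k+1),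
        dampRate k pt β u m j * cip pt j (w t j - Pc j (m-1) (w t j)) v)) t

/-- `Fτ` is the OE (oscillation-eliminating) operator: for every `u ∈ V^k` the damping
initial value problem has a solution `w` and `Fτ u = w τ`. -/
def IsOEOp [NeZero N] (k : ℕ) (pt : Fin (N+1) → ℝ) (β : Fin N → ℝ)
    (Pc : Fin N → ℕ → Polynomial ℝ → Polynomial ℝ) (τ : ℝ)
    (Fτ : (Fin N → Polynomial ℝ) → (Fin N → Polynomial ℝ)) : Prop :=
  ∀ u, MemVk k u → ∃ w, IsDampingSol k pt β Pc u w ∧ Fτ u = w τ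

/-- Right-hand side of the weak form of the upwind DG operator for `u_t + β u_x = 0`:
`β ∫_{I_j} w v_x dx - β w(x_{j+1/2}^-) v(x_{j+1/2}^-) + β w(x_{j-1/2}^-) v(x_{j-1/2}^+)`. -/
noncomputable def dgRHS [NeZero N] (pt : Fin (N+1) → ℝ) (β : ℝ)
    (w : Fin N → Polynomial ℝ) (j : Fin N) (v : Polynomial ℝ) : ℝ :=
  β * (∫ x in (ptL pt j)..(ptR pt j), (w j).eval x * (Polynomial.derivative v).eval x)
  - β * (w j).eval (ptR pt j) * v.eval (ptR pt j)
  + β * (w (j-1)).eval (pt (j-1).succ) * v.eval (ptL pt j)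

/-- `L` is the upwind DG spatial operator on `V^k`. -/
def IsDGOp [NeZero N] (k : ℕ) (pt : Fin (N+1) → ℝ) (β : ℝ)
    (L : (Fin N → Polynomial ℝ) → (Fin N → Polynomial ℝ)) : Prop :=
  ∀ w, MemVk k w → MemVk k (L w) ∧
    ∀ (j : Fin N) (v : Polynomial ℝ), v.natDegree ≤ k →
      cip pt j (L w j) v = dgRHS pt β w j v

/-- The upwind DG bilinear form
`H(w,v) = β ∑_j ∫_{I_j} w v_x dx + β ∑_j w(x_{j+1/2}^-) [v]_{j+1/2}`. -/
noncomputable def Hform [NeZero N] (pt : Fin (N+1) → ℝ) (β : ℝ)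
    (w v : Fin N → Polynomial ℝ) : ℝ :=
  β * ∑ j : Fin N, (∫ x in (ptL pt j)..(ptR pt j),
      (w j).eval x * (Polynomial.derivative (v j)).eval x)
  + β * ∑ j : Fin N, (w j).eval (ptR pt j) * jumpD pt v 0 j

/-- The upwind DG bilinear form with piecewise-smooth first argument. -/
noncomputable def HformF [NeZero N] (pt : Fin (N+1) → ℝ) (β : ℝ)
    (w : Fin N → ℝ → ℝ) (v : Fin N → Polynomial ℝ) : ℝ :=
  β * ∑ j : Fin N, (∫ x in (ptL pt j)..(ptR pt j),
      w j x * (Polynomial.derivative (v j)).eval x)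
  + β * ∑ j : Fin N, w j (ptR pt j) * jumpD pt v 0 j

/-- `L²(Ω)` pairing of a piecewise-smooth function with a piecewise polynomial. -/
noncomputable def ipF (pt : Fin (N+1) → ℝ) (w : Fin N → ℝ → ℝ)
    (v : Fin N → Polynomial ℝ) : ℝ :=
  ∑ j : Fin N, ∫ x in (ptL pt j)..(ptR pt j), w j x * (v j).eval x

/-- One Runge–Kutta stage: `∑_{0≤m≤ℓ} (c_{ℓm} u_σ^{n,m} + τ d_{ℓm} L(u_σ^{n,m}))`. -/
noncomputable def rkStage [NeZero N] (c d : ℕ → ℕ → ℝ) (τ : ℝ)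
    (L : (Fin N → Polynomial ℝ) → (Fin N → Polynomial ℝ))
    (uσ : ℕ → Fin N → Polynomial ℝ) (ℓ : ℕ) : Fin N → Polynomial ℝ :=
  fun j => ∑ m ∈ Finset.range (ℓ+1),
    (Polynomial.C (c ℓ m) * uσ m j + Polynomial.C (τ * d ℓ m) * L (uσ m) j)

/-- One full OEDG time step from `u_σ^n = un`: the stages `u_h^{n,ℓ+1}` and
`u_σ^{n,ℓ+1} = F_τ u_h^{n,ℓ+1}`, `0 ≤ ℓ ≤ s-1`. -/
def IsOEDGStep [NeZero N] (s : ℕ) (c d : ℕ → ℕ → ℝ) (τ : ℝ)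
    (L Fτ : (Fin N → Polynomial ℝ) → (Fin N → Polynomial ℝ))
    (un : Fin N → Polynomial ℝ) (uh uσ : ℕ → Fin N → Polynomial ℝ) : Prop :=
  uσ 0 = un ∧ ∀ ℓ < s, uh (ℓ+1) = rkStage c d τ L uσ ℓ ∧ uσ (ℓ+1) = Fτ (uh (ℓ+1))

/-- The full OEDG evolution: `uσ n ℓ = u_σ^{n,ℓ}` and `uh n ℓ = u_h^{n,ℓ}`, starting from
`u_σ^0 = u0`, with `u_σ^{n+1} = u_σ^{n,s}`. -/
def IsOEDGEvol [NeZero N] (s : ℕ) (c d : ℕ → ℕ → ℝ) (τ : ℝ)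
    (L Fτ : (Fin N → Polynomial ℝ) → (Fin N → Polynomial ℝ))
    (u0 : Fin N → Polynomial ℝ) (uh uσ : ℕ → ℕ → Fin N → Polynomial ℝ) : Prop :=
  uσ 0 0 = u0 ∧ ∀ n, uσ (n+1) 0 = uσ n s ∧
    ∀ ℓ < s, uh n (ℓ+1) = rkStage c d τ L (uσ n) ℓ ∧ uσ n (ℓ+1) = Fτ (uh n (ℓ+1))

/-- `p` is the Gauss–Radau projection of `w` on `[a,b]` into `ℙ^k`:
`∫_a^b (w - p) q dx = 0` for all `q ∈ ℙ^{k-1}` and `p(b) = w(b)`. -/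
def IsGRProj (k : ℕ) (a b : ℝ) (w : ℝ → ℝ) (p : Polynomial ℝ) : Prop :=
  p.natDegree ≤ k ∧
  (∀ q : Polynomial ℝ, q.natDegree < k →
    (∫ x in a..b, (w x - p.eval x) * q.eval x) = 0) ∧
  p.eval b = w b

/-- `u = u(x,t)` is a smooth `1`-periodic exact solution of `u_t + β u_x = 0`. -/
def IsSmoothSolution (β : ℝ) (u : ℝ → ℝ → ℝ) : Prop :=
  ContDiff ℝ (⊤ : ℕ∞) (fun p : ℝ × ℝ => u p.1 p.2) ∧
  (∀ x t, u (x+1) t = u x t) ∧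
  (∀ x t, deriv (fun s => u x s) t + β * deriv (fun y => u y t) x = 0)

/-- Auxiliary table for the reference functions `U^{n,ℓ}`. -/
noncomputable def UrefUpTo (u : ℝ → ℝ → ℝ) (c d : ℕ → ℕ → ℝ) (β τ : ℝ) (n : ℕ) :
    ℕ → ℕ → ℝ → ℝ
  | 0 => fun _ => fun x => u x ((n:ℝ) * τ)
  | (ℓ+1) => fun i =>
      if i ≤ ℓ then UrefUpTo u c d β τ n ℓ i
      else fun x => ∑ m ∈ Finset.range (ℓ+1),
        (c ℓ m * UrefUpTo u c d β τ n ℓ m x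
          - τ * d ℓ m * β * deriv (UrefUpTo u c d β τ n ℓ m) x)

/-- Reference function `U^{n,ℓ}` (for `0 ≤ ℓ ≤ s-1`): `U^{n,0} = u(·, t^n)` and
`U^{n,ℓ+1} = ∑_{0≤m≤ℓ} (c_{ℓm} U^{n,m} - τ d_{ℓm} β ∂_x U^{n,m})`. -/
noncomputable def Uref (u : ℝ → ℝ → ℝ) (c d : ℕ → ℕ → ℝ) (β τ : ℝ) (n ℓ : ℕ) : ℝ → ℝ :=
  UrefUpTo u c d β τ n ℓ ℓ

/-- Reference function `U^{n,ℓ}` including the final stage `U^{n,s} := u(·, t^{n+1})`. -/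
noncomputable def UrefS (u : ℝ → ℝ → ℝ) (c d : ℕ → ℕ → ℝ) (β τ : ℝ) (s n ℓ : ℕ) : ℝ → ℝ :=
  if ℓ = s then fun x => u x (((n:ℝ)+1) * τ) else Uref u c d β τ n ℓ

/-- The Runge–Kutta residual `ρ^{n,s-1}`, defined so that
`U^{n,s} = ∑_{0≤m≤s-1} (c_{s-1,m} U^{n,m} - τ d_{s-1,m} β ∂_x U^{n,m}) + τ ρ^{n,s-1}`. -/
noncomputable def rkRes (u : ℝ → ℝ → ℝ) (c d : ℕ → ℕ → ℝ) (β τ : ℝ) (s n : ℕ) : ℝ → ℝ :=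
  fun x => (u x (((n:ℝ)+1) * τ) - ∑ m ∈ Finset.range s,
    (c (s-1) m * Uref u c d β τ n m x
      - τ * d (s-1) m * β * deriv (Uref u c d β τ n m) x)) / τ

/-- `L²(0,1)` norm of a function. -/
noncomputable def fl2 (f : ℝ → ℝ) : ℝ := Real.sqrt (∫ x in (0:ℝ)..1, (f x)^2)

/-- `L²(Ω)` distance between a piecewise polynomial and a function. -/
noncomputable def errL2 (pt : Fin (N+1) → ℝ) (w : Fin N → Polynomial ℝ) (f : ℝ → ℝ) : ℝ :=
  Real.sqrt (∑ j : Fin N, ∫ x in (ptL pt j)..(ptR pt j), ((w j).eval x - f x)^2)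


lemma ptL_lt_ptR {pt : Fin (N+1) → ℝ} (hpt : IsMesh pt) (j : Fin N) : ptL pt j < ptR pt j :=
  hpt.2.2 Fin.castSucc_lt_succ

lemma cip_comm (pt : Fin (N+1) → ℝ) (j : Fin N) (p q : ℝ[X]) :
    cip pt j p q = cip pt j q p := by
  simp only [cip, mul_comm]

lemma cip_add_left (pt : Fin (N+1) → ℝ) (j : Fin N) (p q r : ℝ[X]) :
    cip pt j (p + q) r = cip pt j p r + cip pt j q r := by
  simp only [cip, eval_add, add_mul]
  exact intervalIntegral.integral_add
    ((p.continuous.mul r.continuous).intervalIntegrable _ _)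
    ((q.continuous.mul r.continuous).intervalIntegrable _ _)

lemma cip_C_mul_left (pt : Fin (N+1) → ℝ) (j : Fin N) (c : ℝ) (p r : ℝ[X]) :
    cip pt j (C c * p) r = c * cip pt j p r := by
  simp only [cip, eval_mul, eval_C, mul_assoc, intervalIntegral.integral_const_mul]

lemma cip_sub_left (pt : Fin (N+1) → ℝ) (j : Fin N) (p q r : ℝ[X]) :
    cip pt j (p - q) r = cip pt j p r - cip pt j q r := by
  rw [eq_sub_iff_add_eq, ← cip_add_left, sub_add_cancel]

lemma cip_sum_C_mul_left (pt : Fin (N+1) → ℝ) (j : Fin N) (s : Finset ℕ) (a : ℕ → ℝ)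
    (φ : ℕ → ℝ[X]) (r : ℝ[X]) :
    cip pt j (∑ i ∈ s, C (a i) * φ i) r = ∑ i ∈ s, a i * cip pt j (φ i) r := by
  induction s using Finset.induction_on with
  | empty => simp [cip]
  | insert i s hi ih => rw [sum_insert hi, sum_insert hi, cip_add_left, cip_C_mul_left, ih]

lemma cip_sum_C_mul_right (pt : Fin (N+1) → ℝ) (j : Fin N) (s : Finset ℕ) (a : ℕ → ℝ)
    (φ : ℕ → ℝ[X]) (r : ℝ[X]) :
    cip pt j r (∑ i ∈ s, C (a i) * φ i) = ∑ i ∈ s, a i * cip pt j r (φ i) := by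
  simp only [cip_comm pt j r, cip_sum_C_mul_left]

lemma eq_zero_of_cip_self_eq_zero {pt : Fin (N+1) → ℝ} (hpt : IsMesh pt) {j : Fin N}
    {p : ℝ[X]} (hp : cip pt j p p = 0) : p = 0 := by
  have hlt := ptL_lt_ptR hpt j
  refine p.eq_zero_of_infinite_isRoot ((Set.Icc_infinite hlt).mono fun x hx => ?_)
  by_contra hne
  exact (intervalIntegral.integral_pos hlt (p.continuous.mul p.continuous).continuousOn
    (fun y _ => mul_self_nonneg _) ⟨x, hx, mul_self_pos.mpr hne⟩).ne' hp

/-- Polynomials with `deg φ i = i` for `i ≤ k` span the polynomials of degree `< n ≤ k + 1`. -/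
lemma exists_eq_sum_of_degree_lt {k : ℕ} {φ : ℕ → ℝ[X]}
    (hdeg : ∀ i, i ≤ k → (φ i).natDegree = i) (hne : ∀ i, i ≤ k → φ i ≠ 0) {n : ℕ}
    (hn : n ≤ k + 1) {p : ℝ[X]} (hp : p.degree < n) :
    ∃ a : ℕ → ℝ, p = ∑ i ∈ range n, C (a i) * φ i := by
  induction n generalizing p with
  | zero => exact ⟨0, by simpa using hp⟩
  | succ n ih =>
    have hnk : n ≤ k := by omega
    have hlead : (φ n).coeff n ≠ 0 := by
      have h := leadingCoeff_ne_zero.mpr (hne n hnk)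
      rwa [leadingCoeff, hdeg n hnk] at h
    set c := p.coeff n / (φ n).coeff n with hc
    have hlt : (p - C c * φ n).degree < n := by
      rw [degree_lt_iff_coeff_zero] at hp ⊢
      intro m hm
      rw [coeff_sub, coeff_C_mul]
      rcases hm.eq_or_lt with rfl | hm
      · rw [hc, div_mul_cancel₀ _ hlead, sub_self]
      · rw [hp m hm, coeff_eq_zero_of_natDegree_lt (by rw [hdeg n hnk]; exact hm)]
        simp
    obtain ⟨a, ha⟩ := ih (by omega) hlt
    refine ⟨Function.update a n c, ?_⟩
    rw [sum_range_succ, Function.update_self, ← sub_eq_iff_eq_add, ha]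
    refine sum_congr rfl fun i hi => ?_
    rw [Function.update_of_ne (mem_range.mp hi).ne]

lemma exists_eq_sum_of_natDegree_le {k : ℕ} {φ : ℕ → ℝ[X]}
    (hdeg : ∀ i, i ≤ k → (φ i).natDegree = i) (hne : ∀ i, i ≤ k → φ i ≠ 0) {n : ℕ}
    (hn : n ≤ k) {p : ℝ[X]} (hp : p.natDegree ≤ n) :
    ∃ a : ℕ → ℝ, p = ∑ i ∈ range (n + 1), C (a i) * φ i :=
  exists_eq_sum_of_degree_lt hdeg hne (by omega)
    (degree_le_natDegree.trans_lt (by exact_mod_cast Nat.lt_succ_of_le hp))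

/-- A polynomial of degree at most `k` is determined by its moments against the basis. -/
lemma eq_of_cip_basis_eq {pt : Fin (N+1) → ℝ} (hpt : IsMesh pt) {j : Fin N} {k : ℕ}
    {φ : ℕ → ℝ[X]} (hdeg : ∀ i, i ≤ k → (φ i).natDegree = i)
    (hne : ∀ i, i ≤ k → φ i ≠ 0) {p q : ℝ[X]} (hp : p.natDegree ≤ k) (hq : q.natDegree ≤ k)
    (h : ∀ i, i ≤ k → cip pt j p (φ i) = cip pt j q (φ i)) : p = q := by
  obtain ⟨a, ha⟩ := exists_eq_sum_of_natDegree_le hdeg hne le_rfl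
    ((natDegree_sub_le p q).trans (max_le hp hq))
  refine sub_eq_zero.mp (eq_zero_of_cip_self_eq_zero hpt (j := j) ?_)
  nth_rewrite 2 [ha]
  rw [cip_sum_C_mul_right]
  refine sum_eq_zero fun i hi => ?_
  rw [cip_sub_left, h i (Nat.lt_succ_iff.mp (mem_range.mp hi)), sub_self, mul_zero]

/-- Moments of the projection residual: those up to the projection degree vanish and the
others are unchanged. -/
lemma cip_sub_proj_basis {pt : Fin (N+1) → ℝ} {Pc : Fin N → ℕ → ℝ[X] → ℝ[X]}
    (hPc : IsCellProj pt Pc) {j : Fin N} {k : ℕ} {φ : ℕ → ℝ[X]}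
    (hdeg : ∀ i, i ≤ k → (φ i).natDegree = i) (hne : ∀ i, i ≤ k → φ i ≠ 0)
    (horth : ∀ i i', i ≤ k → i' ≤ k → i ≠ i' → cip pt j (φ i) (φ i') = 0)
    (d : ℕ) {i : ℕ} (hi : i ≤ k) (p : ℝ[X]) :
    cip pt j (p - Pc j d p) (φ i) = if i ≤ d then 0 else cip pt j p (φ i) := by
  split_ifs with hid
  · exact (hPc j d p).2 _ ((hdeg i hi).trans_le hid)
  · obtain ⟨a, ha⟩ := exists_eq_sum_of_natDegree_le hdeg hne (by omega : d ≤ k) (hPc j d p).1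
    rw [cip_sub_left, ha, cip_sum_C_mul_left, sum_eq_zero, sub_zero]
    intro l hl
    have hl := mem_range.mp hl
    rw [horth l i (by omega) hi (by omega), mul_zero]

/-- Total damping rate of the `i`-th mode on cell `j`. -/
noncomputable def modeRate [NeZero N] (k : ℕ) (pt : Fin (N+1) → ℝ) (β : Fin N → ℝ)
    (u : Fin N → ℝ[X]) (j : Fin N) (i : ℕ) : ℝ :=
  if i = 0 then 0 else ∑ m ∈ range (i+1), dampRate k pt β u m j

lemma sum_dampRate_mul_cip_basis [NeZero N] {pt : Fin (N+1) → ℝ} (β : Fin N → ℝ)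
    {Pc : Fin N → ℕ → ℝ[X] → ℝ[X]} (hPc : IsCellProj pt Pc) {j : Fin N} {k : ℕ}
    {φ : ℕ → ℝ[X]} (hdeg : ∀ i, i ≤ k → (φ i).natDegree = i) (hne : ∀ i, i ≤ k → φ i ≠ 0)
    (horth : ∀ i i', i ≤ k → i' ≤ k → i ≠ i' → cip pt j (φ i) (φ i') = 0)
    (u : Fin N → ℝ[X]) {i : ℕ} (hi : i ≤ k) (p : ℝ[X]) :
    ∑ m ∈ range (k+1), dampRate k pt β u m j * cip pt j (p - Pc j (m-1) p) (φ i)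
      = modeRate k pt β u j i * cip pt j p (φ i) := by
  simp only [cip_sub_proj_basis hPc hdeg hne horth _ hi, modeRate]
  split_ifs with h0
  · simp [h0]
  · rw [sum_mul, ← sum_subset (range_mono (by omega : i + 1 ≤ k + 1))]
    · refine sum_congr rfl fun m hm => ?_
      have hm := mem_range.mp hm
      rw [if_neg (by omega)]
    · intro m _ hm
      have hm : ¬ m < i + 1 := fun h => hm (mem_range.mpr h)
      rw [if_pos (by omega), mul_zero]

lemma eq_exp_mul_of_hasDerivAt {f : ℝ → ℝ} {r : ℝ}
    (hf : ∀ t, HasDerivAt f (-(r * f t)) t) (t : ℝ) : f t = Real.exp (-(r * t)) * f 0 := by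
  have hg : ∀ s, HasDerivAt (fun s => Real.exp (r * s) * f s) 0 s := fun s => by
    refine ((((hasDerivAt_id' s).const_mul r).exp).fun_mul (hf s)).congr_deriv ?_
    ring
  have h := is_const_of_deriv_eq_zero (fun s => (hg s).differentiableAt)
    (fun s => (hg s).deriv) t 0
  simp only [mul_zero, Real.exp_zero, one_mul] at h
  rw [← h, ← mul_assoc, ← Real.exp_add, neg_add_cancel, Real.exp_zero, one_mul]

/-- The explicit trajectory on one cell, in terms of the modal damping rates. -/
noncomputable def modalSol (k : ℕ) (rate coef : ℕ → ℝ) (φ : ℕ → ℝ[X]) (t : ℝ) : ℝ[X] :=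
  ∑ i ∈ range (k+1), C (Real.exp (-(rate i * t)) * coef i) * φ i

lemma modalSol_zero (k : ℕ) (rate coef : ℕ → ℝ) (φ : ℕ → ℝ[X]) :
    modalSol k rate coef φ 0 = ∑ i ∈ range (k+1), C (coef i) * φ i := by
  simp [modalSol]

lemma natDegree_modalSol_le {k : ℕ} (rate coef : ℕ → ℝ) {φ : ℕ → ℝ[X]}
    (hdeg : ∀ i, i ≤ k → (φ i).natDegree = i) (t : ℝ) :
    (modalSol k rate coef φ t).natDegree ≤ k := by
  refine natDegree_sum_le_of_forall_le _ _ fun i hi => (natDegree_C_mul_le _ _).trans ?_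
  have hi := Nat.lt_succ_iff.mp (mem_range.mp hi)
  rwa [hdeg i hi]

lemma cip_modalSol {pt : Fin (N+1) → ℝ} {j : Fin N} {k : ℕ} (rate coef : ℕ → ℝ)
    {φ : ℕ → ℝ[X]}
    (horth : ∀ i i', i ≤ k → i' ≤ k → i ≠ i' → cip pt j (φ i) (φ i') = 0)
    {i : ℕ} (hi : i ≤ k) (t : ℝ) :
    cip pt j (modalSol k rate coef φ t) (φ i)
      = Real.exp (-(rate i * t)) * coef i * cip pt j (φ i) (φ i) := by
  rw [modalSol, cip_sum_C_mul_left, sum_eq_single_of_mem i (mem_range.mpr (by omega))]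
  intro l hl hli
  rw [horth l i (Nat.lt_succ_iff.mp (mem_range.mp hl)) hi hli, mul_zero]

lemma modalSol_modeRate [NeZero N] (k : ℕ) (pt : Fin (N+1) → ℝ) (β : Fin N → ℝ)
    (u : Fin N → ℝ[X]) (j : Fin N) (coef : ℕ → ℝ) (φ : ℕ → ℝ[X]) (t : ℝ) :
    modalSol k (modeRate k pt β u j) coef φ t = C (coef 0) * φ 0
      + ∑ i ∈ Icc 1 k, C (Real.exp (-(β j * t / cellh pt j)
          * ∑ m ∈ range (i+1), sigma k pt u m j) * coef i) * φ i := by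
  rw [modalSol, range_eq_Ico, sum_eq_sum_Ico_succ_bot (Nat.succ_pos k)]
  congr 1
  · simp [modeRate]
  · refine sum_congr (by ext i; simp) fun i hi => ?_
    have hi : i ≠ 0 := by have := (mem_Icc.mp hi).1; omega
    have hrate : modeRate k pt β u j i * t
        = β j * t / cellh pt j * ∑ m ∈ range (i+1), sigma k pt u m j := by
      simp only [modeRate, if_neg hi, dampRate, sum_mul, mul_sum]
      exact sum_congr rfl fun m _ => by ring
    rw [hrate, neg_mul]

/-- Exact solver of the OE procedure.  Let `{φ_j^{(i)}}_{i=0}^k` be an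
`L²(I_j)`-orthogonal basis of `ℙ^k(I_j)` with `deg φ_j^{(i)} = i`, and write
`u|_{I_j} = ∑_i u_j^{(i)} φ_j^{(i)}`.  Then the trajectory
`u_σ(x,t̂) = u_j^{(0)} φ_j^{(0)}(x) + ∑_{i=1}^k exp(-(β_j t̂/h_j) ∑_{m=0}^i σ_j^m(u)) u_j^{(i)} φ_j^{(i)}(x)`
solves the damping IVP, every solution agrees with it for all `t̂ ≥ 0` (uniqueness),
and in particular `F_τ u` multiplies the `i`-th modal coefficient by
`exp(-(β_j τ/h_j) ∑_{m=0}^i σ_j^m(u))` for `i ≥ 1`, leaving the mean unchanged. -/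
theorem oe_exact_solver
    {N : ℕ} [NeZero N] (k : ℕ) (pt : Fin (N+1) → ℝ) (hpt : IsMesh pt)
    (β : Fin N → ℝ) (hβ : ∀ j, 0 ≤ β j)
    (Pc : Fin N → ℕ → Polynomial ℝ → Polynomial ℝ) (hPc : IsCellProj pt Pc)
    (φ : Fin N → ℕ → Polynomial ℝ)
    (hφdeg : ∀ j i, i ≤ k → (φ j i).natDegree = i)
    (hφne : ∀ j i, i ≤ k → φ j i ≠ 0)
    (hφorth : ∀ (j : Fin N) (i i' : ℕ), i ≤ k → i' ≤ k → i ≠ i' →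
      cip pt j (φ j i) (φ j i') = 0)
    (coef : Fin N → ℕ → ℝ)
    (u : Fin N → Polynomial ℝ)
    (hu : ∀ j, u j = ∑ i ∈ Finset.range (k+1), Polynomial.C (coef j i) * φ j i) :
    (IsDampingSol k pt β Pc u (fun t j =>
        Polynomial.C (coef j 0) * φ j 0
        + ∑ i ∈ Finset.Icc 1 k,
            Polynomial.C (Real.exp (-(β j * t / cellh pt j)
                * ∑ m ∈ Finset.range (i+1), sigma k pt u m j) * coef j i) * φ j i)) ∧
    (∀ w : ℝ → Fin N → Polynomial ℝ, IsDampingSol k pt β Pc u w →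
      ∀ t : ℝ, 0 ≤ t → ∀ j : Fin N,
        w t j = Polynomial.C (coef j 0) * φ j 0
          + ∑ i ∈ Finset.Icc 1 k,
              Polynomial.C (Real.exp (-(β j * t / cellh pt j)
                  * ∑ m ∈ Finset.range (i+1), sigma k pt u m j) * coef j i) * φ j i) ∧
    (∀ τ : ℝ, 0 ≤ τ →
      ∀ Fτ : (Fin N → Polynomial ℝ) → (Fin N → Polynomial ℝ), IsOEOp k pt β Pc τ Fτ →
      Fτ u = fun j =>
        Polynomial.C (coef j 0) * φ j 0
        + ∑ i ∈ Finset.Icc 1 k,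
            Polynomial.C (Real.exp (-(β j * τ / cellh pt j)
                * ∑ m ∈ Finset.range (i+1), sigma k pt u m j) * coef j i) * φ j i) := by
  simp only [← modalSol_modeRate]
  have huniq : ∀ w : ℝ → Fin N → ℝ[X], IsDampingSol k pt β Pc u w → ∀ t j,
      w t j = modalSol k (modeRate k pt β u j) (coef j) (φ j) t := by
    intro w hw t j
    refine eq_of_cip_basis_eq hpt (j := j) (hφdeg j) (hφne j) (hw.2.1 t j)
      (natDegree_modalSol_le _ _ (hφdeg j) t) fun i hi => ?_
    have hderiv := fun s => hw.2.2 s j (φ j i) ((hφdeg j i hi).trans_le hi)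
    simp only [sum_dampRate_mul_cip_basis β hPc (hφdeg j) (hφne j) (hφorth j) u hi] at hderiv
    rw [eq_exp_mul_of_hasDerivAt hderiv t, cip_modalSol _ _ (hφorth j) hi, hw.1, hu j,
      ← modalSol_zero k (modeRate k pt β u j), cip_modalSol _ _ (hφorth j) hi]
    simp [mul_assoc]
  refine ⟨⟨?_, fun t j => natDegree_modalSol_le _ _ (hφdeg j) t, ?_⟩,
    fun w hw t _ j => huniq w hw t j, ?_⟩
  · funext j
    dsimp only
    rw [modalSol_zero, hu j]
  · intro t j v hv
    obtain ⟨a, rfl⟩ := exists_eq_sum_of_natDegree_le (hφdeg j) (hφne j) le_rfl hv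
    simp only [cip_sum_C_mul_right, mul_sum]
    rw [sum_comm, ← sum_neg_distrib]
    refine HasDerivAt.fun_sum fun i hi => ?_
    have hi := Nat.lt_succ_iff.mp (mem_range.mp hi)
    simp only [mul_left_comm _ (a i)]
    rw [← mul_sum, sum_dampRate_mul_cip_basis β hPc (hφdeg j) (hφne j) (hφorth j) u hi,
      ← mul_neg]
    refine HasDerivAt.const_mul _ ?_
    simp only [cip_modalSol _ _ (hφorth j) hi, mul_assoc]
    have h := (((hasDerivAt_id' t).const_mul (modeRate k pt β u j i)).fun_neg.exp).mul_const
      (coef j i * cip pt j (φ j i) (φ j i))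
    convert h using 1
    ring
  · intro τ _ Fτ hF
    obtain ⟨w, hw, hFw⟩ := hF u fun j => by
      rw [hu j, ← modalSol_zero k 0]
      exact natDegree_modalSol_le _ _ (hφdeg j) 0
    rw [hFw]
    exact funext fun j => huniq w hw τ j

end OEDG
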